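/- (Second decomposition lemma) The weighted sums satisfy S_2^{(1)}(f+u, f) = Σ_{v=0}^{u} S_3^{(1)}(f+u, f, v) and S_2^{(2)}(f+u, f) = Σ_{v=0}^{u} S_3^{(2)}(f+u, f, v), where S_3^{(1)}(f+u, f, v) = α·C(f+v−1, f−1)·p·X_{2f}·S^{(2)}(u, v) and S_3^{(2)}(f+u, f, v) = (1−α)·C(f+v−1, f−1)·p·X_{2f}·S^{(1)}(u, v). -/

import Mathlib

open scoped Classical

/-- `w` is a closed walk of `k` steps over `ℕ`: a list `(w_1, …, w_{k+1})` with `w_{k+1} = w_1`,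
each step joining two distinct vertices. -/
def IsClosedWalk (k : ℕ) (w : List ℕ) : Prop :=
  w.length = k + 1 ∧ w.getD k 0 = w.getD 0 0 ∧ ∀ i < k, w.getD i 0 ≠ w.getD (i + 1) 0

/-- The vertex set `V_w` of the walk. -/
def vertexSet (w : List ℕ) : Finset ℕ := w.toFinset

/-- The edge set `E_w = ∪_i {(w_i, w_{i+1})}` (unordered pairs) of the skeleton of `w`. -/
def edgeSet (k : ℕ) (w : List ℕ) : Finset (Sym2 ℕ) :=
  (Finset.range k).image fun i => s(w.getD i 0, w.getD (i + 1) 0)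

/-- `n_w(e)`: the number of traversals of the edge `e` by `w`, in either direction. -/
def traversals (k : ℕ) (w : List ℕ) (e : Sym2 ℕ) : ℕ :=
  ((Finset.range k).filter fun i => s(w.getD i 0, w.getD (i + 1) 0) = e).card

/-- `w` is minimal: `w_1 = 1` and each newly visited vertex gets the number equal to one plus
the number of previously visited vertices. -/
def IsMinimal (k : ℕ) (w : List ℕ) : Prop :=
  w.getD 0 0 = 1 ∧ ∀ i < k,
    w.getD (i + 1) 0 ∈ (w.take (i + 1)).toFinset ∨
      w.getD (i + 1) 0 = (w.take (i + 1)).toFinset.card + 1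

/-- The skeleton graph `G_w` of the walk `w`. -/
def skeleton (k : ℕ) (w : List ℕ) : SimpleGraph ℕ :=
  SimpleGraph.fromEdgeSet ↑(edgeSet k w)

/-- `w` is an essential walk: a minimal closed walk whose skeleton is a tree. -/
def IsEssential (k : ℕ) (w : List ℕ) : Prop :=
  IsClosedWalk k w ∧ IsMinimal k w ∧
    ((skeleton k w).induce (↑(vertexSet w) : Set ℕ)).IsTree

/-- `β(w)`: the number of vertices of `V_w` at even distance from the root `ρ = w_1`
in the tree `G_w`. -/
noncomputable def beta (k : ℕ) (w : List ℕ) : ℕ :=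
  Set.ncard {v | v ∈ vertexSet w ∧ Even ((skeleton k w).dist (w.getD 0 0) v)}

/-- The weight `θ_1(w) = α^{β(w)} (1-α)^{|V_w|-β(w)} ∏_{e∈E_w} p X_{n_w(e)}`. -/
noncomputable def theta1 (p α : ℝ) (X : ℕ → ℝ) (k : ℕ) (w : List ℕ) : ℝ :=
  α ^ beta k w * (1 - α) ^ ((vertexSet w).card - beta k w) *
    ∏ e ∈ edgeSet k w, p * X (traversals k w e)

/-- The weight `θ_2(w) = (1-α)^{β(w)} α^{|V_w|-β(w)} ∏_{e∈E_w} p X_{n_w(e)}`. -/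
noncomputable def theta2 (p α : ℝ) (X : ℕ → ℝ) (k : ℕ) (w : List ℕ) : ℝ :=
  (1 - α) ^ beta k w * α ^ ((vertexSet w).card - beta k w) *
    ∏ e ∈ edgeSet k w, p * X (traversals k w e)

/-- The number `r` of steps of `w` starting from the root `ρ = w_1`. -/
def rootSteps (k : ℕ) (w : List ℕ) : ℕ :=
  ((Finset.range k).filter fun i => w.getD i 0 = w.getD 0 0).card

/-- `Λ(l,r)`: the set of essential walks of length `2l` with `r` steps starting from the root. -/
def Lambda (l r : ℕ) : Set (List ℕ) :=
  {w | IsEssential (2 * l) w ∧ rootSteps (2 * l) w = r}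

/-- `S⁽¹⁾(l,r)`: the sum of the weights `θ_1` of the walks of `Λ(l,r)`. -/
noncomputable def S1 (p α : ℝ) (X : ℕ → ℝ) (l r : ℕ) : ℝ :=
  ∑ᶠ w ∈ Lambda l r, theta1 p α X (2 * l) w

/-- `S⁽²⁾(l,r)`: the sum of the weights `θ_2` of the walks of `Λ(l,r)`. -/
noncomputable def S2 (p α : ℝ) (X : ℕ → ℝ) (l r : ℕ) : ℝ :=
  ∑ᶠ w ∈ Lambda l r, theta2 p α X (2 * l) w

/-- The skeleton of `w` with the first edge `(ρ,ν) = (w_1,w_2)` removed. -/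
def prunedSkeleton (k : ℕ) (w : List ℕ) : SimpleGraph ℕ :=
  SimpleGraph.fromEdgeSet (↑(edgeSet k w) \ {s(w.getD 0 0, w.getD 1 0)})

/-- Twice the half-length `u` of the walk restricted to the component `G_2` of `ν` obtained by
deleting the edge `(ρ,ν)` from `G_w`: the number of steps of `w` along edges of `G_2`. -/
noncomputable def nuSteps (k : ℕ) (w : List ℕ) : ℕ :=
  ((Finset.range k).filter fun i =>
    s(w.getD i 0, w.getD (i + 1) 0) ≠ s(w.getD 0 0, w.getD 1 0) ∧
      (prunedSkeleton k w).Reachable (w.getD 1 0) (w.getD i 0)).card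

/-- `Λ_1(l,r,u,f)`: the walks of `Λ(l,r)` traversing the first edge `(ρ,ν)` exactly `f` times
and whose restriction to the component of `ν` has half-length `u`. -/
def Lambda1 (l r u f : ℕ) : Set (List ℕ) :=
  {w | w ∈ Lambda l r ∧ traversals (2 * l) w s(w.getD 0 0, w.getD 1 0) = f ∧
    nuSteps (2 * l) w = 2 * u}

/-- `Λ_2(l,r)`: the walks of `Λ(l,r)` whose skeleton has exactly one edge attached
to the root. -/
def Lambda2 (l r : ℕ) : Set (List ℕ) :=
  {w | w ∈ Lambda l r ∧ ((edgeSet (2 * l) w).filter fun e => w.getD 0 0 ∈ e).card = 1}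

/-- `S⁽¹⁾_1(l,r,u,f)`: the sum of the weights `θ_1` of the walks of `Λ_1(l,r,u,f)`. -/
noncomputable def S1₁ (p α : ℝ) (X : ℕ → ℝ) (l r u f : ℕ) : ℝ :=
  ∑ᶠ w ∈ Lambda1 l r u f, theta1 p α X (2 * l) w

/-- `S⁽²⁾_1(l,r,u,f)`: the sum of the weights `θ_2` of the walks of `Λ_1(l,r,u,f)`. -/
noncomputable def S2₁ (p α : ℝ) (X : ℕ → ℝ) (l r u f : ℕ) : ℝ :=
  ∑ᶠ w ∈ Lambda1 l r u f, theta2 p α X (2 * l) w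

/-- `S⁽¹⁾_2(l,r)`: the sum of the weights `θ_1` of the walks of `Λ_2(l,r)`. -/
noncomputable def S1₂ (p α : ℝ) (X : ℕ → ℝ) (l r : ℕ) : ℝ :=
  ∑ᶠ w ∈ Lambda2 l r, theta1 p α X (2 * l) w

/-- `S⁽²⁾_2(l,r)`: the sum of the weights `θ_2` of the walks of `Λ_2(l,r)`. -/
noncomputable def S2₂ (p α : ℝ) (X : ℕ → ℝ) (l r : ℕ) : ℝ :=
  ∑ᶠ w ∈ Lambda2 l r, theta2 p α X (2 * l) w

/-- `v`: the number of steps of `w` starting from `ν = w_2` other than the steps `ν → ρ`. -/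
def nuOutSteps (k : ℕ) (w : List ℕ) : ℕ :=
  ((Finset.range k).filter fun i =>
    w.getD i 0 = w.getD 1 0 ∧ w.getD (i + 1) 0 ≠ w.getD 0 0).card

/-- `Λ_3(l,f,v)`: the walks of `Λ_2(l,f)` with exactly `v` steps starting from `ν`
other than `ν → ρ`. -/
def Lambda3 (l f v : ℕ) : Set (List ℕ) :=
  {w | w ∈ Lambda2 l f ∧ nuOutSteps (2 * l) w = v}

/-- `S⁽¹⁾_3(l,f,v)`: the sum of the weights `θ_1` of the walks of `Λ_3(l,f,v)`. -/
noncomputable def S1₃ (p α : ℝ) (X : ℕ → ℝ) (l f v : ℕ) : ℝ :=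
  ∑ᶠ w ∈ Lambda3 l f v, theta1 p α X (2 * l) w

/-- `S⁽²⁾_3(l,f,v)`: the sum of the weights `θ_2` of the walks of `Λ_3(l,f,v)`. -/
noncomputable def S2₃ (p α : ℝ) (X : ℕ → ℝ) (l f v : ℕ) : ℝ :=
  ∑ᶠ w ∈ Lambda3 l f v, theta2 p α X (2 * l) w

/-- The multiset of directed steps of a walk. -/
def steps (w : List ℕ) : Multiset (ℕ × ℕ) := (w.zip w.tail : List (ℕ × ℕ))

@[simp] lemma steps_singleton (a : ℕ) : steps [a] = 0 := rfl

@[simp] lemma steps_cons_cons (a b : ℕ) (t : List ℕ) :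
    steps (a :: b :: t) = (a, b) ::ₘ steps (b :: t) := rfl

lemma card_steps {k : ℕ} {w : List ℕ} (h : w.length = k + 1) : (steps w).card = k := by
  simp [steps, h]

lemma map_range_eq_steps {k : ℕ} {w : List ℕ} (h : w.length = k + 1) :
    (Finset.range k).val.map (fun i => (w.getD i 0, w.getD (i + 1) 0)) = steps w := by
  rw [steps, Finset.range_val, Multiset.range, Multiset.map_coe, Multiset.coe_eq_coe]
  refine List.Perm.of_eq (List.ext_getElem (by simp [h]) fun i h₁ h₂ => ?_)
  simp only [List.length_map, List.length_range] at h₁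
  simp [h, h₁, show i < k + 1 by omega]

lemma card_filter_range {k : ℕ} {w : List ℕ} (h : w.length = k + 1) (P : ℕ × ℕ → Prop)
    [DecidablePred P] :
    ((Finset.range k).filter fun i => P (w.getD i 0, w.getD (i + 1) 0)).card
      = (steps w).countP P := by
  rw [← map_range_eq_steps h, Multiset.countP_map]
  rfl

lemma mem_steps_iff {k : ℕ} {w : List ℕ} (h : w.length = k + 1) (x : ℕ × ℕ) :
    x ∈ steps w ↔ ∃ i < k, (w.getD i 0, w.getD (i + 1) 0) = x := by
  simp [← map_range_eq_steps h]

lemma edgeSet_eq {k : ℕ} {w : List ℕ} (h : w.length = k + 1) :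
    edgeSet k w = ((steps w).map fun x => s(x.1, x.2)).toFinset := by
  ext e
  simp [edgeSet, mem_steps_iff h]

lemma mem_edgeSet_iff {k : ℕ} {w : List ℕ} (h : w.length = k + 1) (a b : ℕ) :
    s(a, b) ∈ edgeSet k w ↔ (a, b) ∈ steps w ∨ (b, a) ∈ steps w := by
  simp only [edgeSet_eq h, Multiset.mem_toFinset, Multiset.mem_map, Prod.exists, Sym2.eq_iff]
  constructor
  · rintro ⟨x, y, h, ⟨rfl, rfl⟩ | ⟨rfl, rfl⟩⟩ <;> simp [h]
  · rintro (h | h)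
    · exact ⟨a, b, h, by simp⟩
    · exact ⟨b, a, h, by simp⟩

lemma traversals_eq {k : ℕ} {w : List ℕ} (h : w.length = k + 1) (e : Sym2 ℕ) :
    traversals k w e = (steps w).countP fun x => s(x.1, x.2) = e :=
  card_filter_range h fun x => s(x.1, x.2) = e

lemma rootSteps_eq {k : ℕ} {w : List ℕ} (h : w.length = k + 1) :
    rootSteps k w = (steps w).countP fun x => x.1 = w.getD 0 0 :=
  card_filter_range h fun x => x.1 = w.getD 0 0

lemma nuOutSteps_eq {k : ℕ} {w : List ℕ} (h : w.length = k + 1) :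
    nuOutSteps k w = (steps w).countP fun x => x.1 = w.getD 1 0 ∧ x.2 ≠ w.getD 0 0 :=
  card_filter_range h fun x => x.1 = w.getD 1 0 ∧ x.2 ≠ w.getD 0 0

lemma mem_of_mem_steps {w : List ℕ} {a b : ℕ} (h : (a, b) ∈ steps w) : a ∈ w ∧ b ∈ w := by
  have := List.of_mem_zip (show (a, b) ∈ w.zip w.tail from h)
  exact ⟨this.1, List.mem_of_mem_tail this.2⟩

/-- A walk leaves the vertex `1` in at most every other step. -/
lemma two_mul_countP_le (a : ℕ) (t : List ℕ) (h : ∀ x ∈ steps (a :: t), x.1 ≠ x.2) :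
    2 * (steps (a :: t)).countP (fun x => x.1 = 1)
      ≤ (steps (a :: t)).card + if a = 1 then 1 else 0 := by
  induction t generalizing a with
  | nil => simp
  | cons b t ih =>
    have hb := ih b fun x hx => h x (by simp [hx])
    have hab : a ≠ b := h (a, b) (by simp)
    simp only [steps_cons_cons, Multiset.countP_cons, Multiset.card_cons]
    split_ifs at * <;> omega

/-- Minimality of the continuation `t` of a walk that has visited the vertices in `S`. -/
def MinimalFrom : Finset ℕ → List ℕ → Prop
  | _, [] => True
  | S, x :: t => (x ∈ S ∨ x = S.card + 1) ∧ MinimalFrom (insert x S) t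

lemma minimalFrom_iff (P t : List ℕ) :
    MinimalFrom P.toFinset t ↔ ∀ i < t.length,
      t.getD i 0 ∈ (P ++ t.take i).toFinset ∨
        t.getD i 0 = (P ++ t.take i).toFinset.card + 1 := by
  induction t generalizing P with
  | nil => simp [MinimalFrom]
  | cons x t ih =>
    have hP : insert x P.toFinset = (P ++ [x]).toFinset := by
      ext; simp
    rw [MinimalFrom, hP, ih, List.length_cons, Nat.forall_lt_succ_left]
    simp

lemma isMinimal_iff {k : ℕ} {a : ℕ} {t : List ℕ} (h : (a :: t).length = k + 1) :
    IsMinimal k (a :: t) ↔ a = 1 ∧ MinimalFrom {1} t := by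
  obtain rfl : t.length = k := by simpa using h
  rw [IsMinimal, List.getD_cons_zero]
  refine and_congr_right ?_
  rintro rfl
  have := minimalFrom_iff [1] t
  simp only [List.toFinset_cons, List.toFinset_nil, insert_empty_eq] at this
  rw [this]
  simp

lemma MinimalFrom.bounds {S : Finset ℕ} {t : List ℕ} (h : MinimalFrom S t)
    (hS : ∀ x ∈ S, 0 < x ∧ x ≤ S.card) : ∀ x ∈ t, 0 < x ∧ x ≤ S.card + t.length := by
  induction t generalizing S with
  | nil => simp
  | cons y t ih =>
    obtain ⟨hy, ht⟩ := h
    have hcard : (insert y S).card ≤ S.card + 1 := Finset.card_insert_le _ _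
    have hle : S.card ≤ (insert y S).card := Finset.card_le_card (Finset.subset_insert _ _)
    have hy' : 0 < y ∧ y ≤ (insert y S).card := by
      rcases hy with hy | rfl
      · exact ⟨(hS y hy).1, (hS y hy).2.trans hle⟩
      · have : S.card + 1 ∉ S := fun hm => by have := hS _ hm; omega
        simp [Finset.card_insert_of_notMem this]
    have := ih ht fun x hx => by
      rcases Finset.mem_insert.1 hx with rfl | hx
      · exact hy'
      · exact ⟨(hS x hx).1, (hS x hx).2.trans hle⟩
    intro x hx
    rw [List.length_cons]
    rcases List.mem_cons.1 hx with rfl | hx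
    · omega
    · have := this x hx
      omega

lemma isClosedWalk_iff {k : ℕ} {w : List ℕ} :
    IsClosedWalk k w ↔ w.length = k + 1 ∧ w.getLast? = w.head? ∧
      ∀ x ∈ steps w, x.1 ≠ x.2 := by
  refine and_congr_right fun h => and_congr ?_ ?_
  · rw [List.getLast?_eq_getElem?, h, Nat.add_sub_cancel, List.head?_eq_getElem?]
    simp [h]
  · simp only [mem_steps_iff h]
    constructor
    · rintro H _ ⟨i, hi, rfl⟩
      exact H i hi
    · exact fun H i hi => H _ ⟨i, hi, rfl⟩

lemma skeleton_adj {k : ℕ} {w : List ℕ} (h : w.length = k + 1)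
    (hne : ∀ x ∈ steps w, x.1 ≠ x.2) (a b : ℕ) :
    (skeleton k w).Adj a b ↔ (a, b) ∈ steps w ∨ (b, a) ∈ steps w := by
  rw [skeleton, SimpleGraph.fromEdgeSet_adj, Finset.mem_coe, mem_edgeSet_iff h]
  refine ⟨And.left, fun H => ⟨H, ?_⟩⟩
  rcases H with H | H
  · exact hne _ H
  · exact (hne _ H).symm

lemma induce_reachable_of_steps {G : SimpleGraph ℕ} {V : Set ℕ} (a : ℕ) (t : List ℕ)
    (hV : ∀ x ∈ a :: t, x ∈ V) (hG : ∀ x ∈ steps (a :: t), G.Adj x.1 x.2) :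
    ∀ x, ∀ hx : x ∈ a :: t,
      (G.induce V).Reachable ⟨a, hV a (by simp)⟩ ⟨x, hV x hx⟩ := by
  induction t generalizing a with
  | nil =>
    intro x hx
    obtain rfl : x = a := by simpa using hx
    exact .rfl
  | cons b t ih =>
    intro x hx
    rcases List.mem_cons.1 hx with rfl | hx'
    · exact .rfl
    · have hab : (G.induce V).Adj ⟨a, hV a (by simp)⟩ ⟨b, hV b (by simp)⟩ :=
        hG (a, b) (by simp)
      exact hab.reachable.trans
        (ih b (fun y hy => hV y (by simp [hy])) (fun y hy => hG y (by simp [hy])) x hx')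

/-- The skeleton of a walk is connected. -/
lemma skeleton_connected {k a : ℕ} {t : List ℕ} (h : (a :: t).length = k + 1)
    (hne : ∀ x ∈ steps (a :: t), x.1 ≠ x.2) :
    ((skeleton k (a :: t)).induce (↑(vertexSet (a :: t)) : Set ℕ)).Connected := by
  have hV : ∀ x ∈ a :: t, x ∈ (↑(vertexSet (a :: t)) : Set ℕ) := fun x hx => by
    simpa [vertexSet] using hx
  have := induce_reachable_of_steps (G := skeleton k (a :: t)) a t hV
    fun x hx => (skeleton_adj h hne _ _).2 (.inl hx)
  have hne' : Nonempty (↑(↑(vertexSet (a :: t)) : Set ℕ)) := ⟨⟨a, hV a (by simp)⟩⟩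
  refine ⟨fun x y => ?_⟩
  have hx := this x (List.mem_toFinset.1 x.2)
  have hy := this y (List.mem_toFinset.1 y.2)
  exact hx.symm.trans hy

lemma skeleton_reachable {k a : ℕ} {t : List ℕ} (h : (a :: t).length = k + 1)
    (hne : ∀ x ∈ steps (a :: t), x.1 ≠ x.2) {x : ℕ} (hx : x ∈ a :: t) :
    (skeleton k (a :: t)).Reachable a x := by
  have ha : a ∈ vertexSet (a :: t) := by simp [vertexSet]
  have hx' : x ∈ vertexSet (a :: t) := by simpa [vertexSet] using hx
  exact ((skeleton_connected h hne).preconnected ⟨a, ha⟩ ⟨x, hx'⟩).map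
    (SimpleGraph.Embedding.induce _).toHom

lemma skeleton_isTree_iff {k a : ℕ} {t : List ℕ} (h : (a :: t).length = k + 1)
    (hne : ∀ x ∈ steps (a :: t), x.1 ≠ x.2) :
    ((skeleton k (a :: t)).induce (↑(vertexSet (a :: t)) : Set ℕ)).IsTree ↔
      (edgeSet k (a :: t)).card + 1 = (vertexSet (a :: t)).card := by
  rw [SimpleGraph.isTree_iff_connected_and_card]
  have hV : Nat.card (↑(↑(vertexSet (a :: t)) : Set ℕ)) = (vertexSet (a :: t)).card := by
    simp
  have hE : Nat.card ((skeleton k (a :: t)).induce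
      (↑(vertexSet (a :: t)) : Set ℕ)).edgeSet = (edgeSet k (a :: t)).card := by
    rw [Nat.card_coe_set_eq,
      ← Set.ncard_image_of_injective _ (Sym2.map.injective Subtype.val_injective),
      ← Set.ncard_coe_finset]
    congr 1
    ext e
    induction e with | _ x y
    constructor
    · rintro ⟨e, he, hxy⟩
      rw [← hxy]
      induction e with | _ a b
      exact (mem_edgeSet_iff h _ _).2 ((skeleton_adj h hne _ _).1 he)
    · intro hxy
      have hadj := (mem_edgeSet_iff h _ _).1 hxy
      have hmem : x ∈ vertexSet (a :: t) ∧ y ∈ vertexSet (a :: t) := by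
        simp only [vertexSet, List.mem_toFinset]
        rcases hadj with H | H
        · exact mem_of_mem_steps H
        · exact (mem_of_mem_steps H).symm
      exact ⟨s(⟨x, hmem.1⟩, ⟨y, hmem.2⟩), (skeleton_adj h hne x y).2 hadj, rfl⟩
  rw [hV, hE]
  simp [skeleton_connected h hne]

lemma dist_one_succ {G G' : SimpleGraph ℕ}
    (hG : ∀ a b, G.Adj a b → (a = 1 ∧ b = 2) ∨ (a = 2 ∧ b = 1) ∨
      ∃ x y, a = x + 1 ∧ b = y + 1 ∧ x ≠ 0 ∧ y ≠ 0 ∧ G'.Adj x y)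
    (h₁ : G.Adj 1 2) (hG' : ∀ x y, G'.Adj x y → G.Adj (x + 1) (y + 1))
    {x : ℕ} (hx : x ≠ 0) (hr : G'.Reachable 1 x) :
    G.dist 1 (x + 1) = G'.dist 1 x + 1 := by
  obtain ⟨q, hq⟩ := hr.exists_walk_length_eq_dist
  have hle : G.dist 1 (x + 1) ≤ G'.dist 1 x + 1 := by
    let F : G' →g G := ⟨fun x => x + 1, fun h => hG' _ _ h⟩
    have := SimpleGraph.dist_le (SimpleGraph.Walk.cons h₁ (q.map F))
    rwa [SimpleGraph.Walk.length_cons, SimpleGraph.Walk.length_map, hq] at this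
  refine le_antisymm hle ?_
  have hlip : ∀ a b, G.Adj a b → (if b = 1 then 0 else G'.dist 1 (b - 1) + 1)
      ≤ (if a = 1 then 0 else G'.dist 1 (a - 1) + 1) + 1 := by
    intro a b hab
    rcases hG a b hab with ⟨rfl, rfl⟩ | ⟨rfl, rfl⟩ | ⟨x, y, rfl, rfl, hx, hy, hxy⟩
    · simp
    · simp
    · simp only [add_eq_right, hx, hy, if_false, Nat.add_sub_cancel, add_le_add_iff_right]
      by_cases h : G'.Reachable 1 x
      · obtain ⟨q, hq⟩ := h.exists_walk_length_eq_dist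
        simpa [hq] using SimpleGraph.dist_le (q.concat hxy)
      · rw [SimpleGraph.dist_eq_zero_of_not_reachable
          fun hy => h (hy.trans hxy.symm.reachable)]
        exact Nat.zero_le _
  have hwalk : ∀ {a b} (p : G.Walk a b), (if b = 1 then 0 else G'.dist 1 (b - 1) + 1)
      ≤ (if a = 1 then 0 else G'.dist 1 (a - 1) + 1) + p.length := by
    intro a b p
    induction p with
    | nil => simp
    | cons h p ih =>
      have := hlip _ _ h
      rw [SimpleGraph.Walk.length_cons]
      omega
  have hreach : G.Reachable 1 (x + 1) := by
    let F : G' →g G := ⟨fun x => x + 1, fun h => hG' _ _ h⟩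
    exact ⟨SimpleGraph.Walk.cons h₁ (q.map F)⟩
  obtain ⟨p, hp⟩ := hreach.exists_walk_length_eq_dist
  simpa [hp, hx] using hwalk p

/-- `Inserted r m t`: the list `t` arises from `r`, a walk ending at `1`, by raising all labels
by one, inserting `m` excursions `2 → 1 → 2` at occurrences of `2`, and appending a last `1`. -/
inductive Inserted : List ℕ → ℕ → List ℕ → Prop
  | base : Inserted [1] 0 [2, 1]
  | step {x y m : ℕ} {r t : List ℕ} : Inserted (y :: r) m ((y + 1) :: t) →
      Inserted (x :: y :: r) m ((x + 1) :: (y + 1) :: t)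
  | detour {m : ℕ} {r t : List ℕ} : Inserted (1 :: r) m (2 :: t) →
      Inserted (1 :: r) (m + 1) (2 :: 1 :: 2 :: t)

namespace Inserted

variable {x m : ℕ} {r t : List ℕ}

lemma exists_cons (h : Inserted r m t) : ∃ x r' t', r = x :: r' ∧ t = (x + 1) :: t' := by
  cases h <;> exact ⟨_, _, _, rfl, rfl⟩

lemma getLast (h : Inserted r m t) : r.getLast? = some 1 ∧ t.getLast? = some 1 := by
  induction h <;> simp_all

lemma steps_eq (h : Inserted r m t) :
    steps t = (steps r).map (Prod.map (· + 1) (· + 1)) + m • {(1, 2)} + (m + 1) • {(2, 1)} := by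
  induction h with
  | base => simp
  | step h ih =>
    rw [steps_cons_cons, ih]
    simp
  | @detour m r t h ih =>
    rw [steps_cons_cons, steps_cons_cons, ih, ← Multiset.singleton_add (2, 1),
      ← Multiset.singleton_add (1, 2)]
    simp only [add_nsmul, one_nsmul]
    ac_rfl

lemma mem_iff (h : Inserted r m t) (z : ℕ) : z ∈ t ↔ z = 1 ∨ ∃ x ∈ r, z = x + 1 := by
  induction h with
  | base => simp [or_comm]
  | step h ih =>
    rw [List.mem_cons, ih]
    simp
    tauto
  | detour h ih =>
    rw [List.mem_cons, List.mem_cons, ih]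
    simp
    tauto

lemma minimalFrom_iff (h : Inserted (x :: r) m ((x + 1) :: t)) (h0 : 0 ∉ x :: r)
    {S : Finset ℕ} (hS : 0 ∉ S) (hx : x ∈ S) (h1 : 1 ∈ S) :
    MinimalFrom (insert 1 (S.image (· + 1))) t ↔ MinimalFrom S r := by
  generalize hr : x :: r = r₀ at h
  generalize ht : (x + 1) :: t = t₀ at h
  induction h generalizing x r t S with
  | base =>
    obtain ⟨rfl, rfl⟩ := List.cons.inj hr
    obtain ⟨-, rfl⟩ := List.cons.inj ht
    simp [MinimalFrom]
  | @step x y m r t h ih =>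
    obtain ⟨rfl, rfl⟩ := List.cons.inj hr
    obtain ⟨-, rfl⟩ := List.cons.inj ht
    have hy : y ≠ 0 := by rintro rfl; simp at h0
    have hcard : (insert 1 (S.image (· + 1))).card = S.card + 1 := by
      rw [Finset.card_insert_of_notMem (by simpa using hS),
        Finset.card_image_of_injective _ (add_left_injective 1)]
    have := ih (x := y) (r := r) (t := t) (S := insert y S) (by simp_all) (by simp [hS, hy.symm])
      (by simp) (by simp [h1]) rfl rfl
    rw [MinimalFrom, MinimalFrom, hcard, ← this, Finset.image_insert, Finset.insert_comm]
    simp [hy]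
  | @detour m r t h ih =>
    obtain ⟨rfl, rfl⟩ := List.cons.inj hr
    obtain ⟨-, rfl⟩ := List.cons.inj ht
    have := ih h0 hS hx h1 rfl rfl
    rw [MinimalFrom, MinimalFrom, ← this]
    simp [h1]

lemma exists_of_steps (t : List ℕ) (y : ℕ) (h0 : 0 ∉ y :: t) (hy : y ≠ 1)
    (hlast : (y :: t).getLast? = some 1)
    (hsteps : ∀ z ∈ steps (y :: t), (z.1 = 1 ↔ z = (1, 2)) ∧ (z.2 = 1 ↔ z = (2, 1))) :
    ∃ r m, 0 ∉ r ∧ Inserted r m (y :: t) := by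
  match t with
  | [] => simp_all
  | [z] =>
    obtain rfl : z = 1 := by simpa using hlast
    obtain rfl : y = 2 := by simpa using (hsteps (y, 1) (by simp)).2
    exact ⟨[1], 0, by simp, .base⟩
  | z :: z' :: t =>
    by_cases hz : z = 1
    · subst hz
      obtain rfl : y = 2 := by simpa using (hsteps (y, 1) (by simp)).2
      obtain rfl : z' = 2 := by simpa using (hsteps (1, z') (by simp)).1
      obtain ⟨r, m, hr, h⟩ := exists_of_steps t 2 (by simp_all) (by simp) (by simp_all)
        fun z hz => hsteps z (by simp [hz])
      obtain ⟨x, r, t, rfl, ht⟩ := h.exists_cons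
      obtain ⟨hx, rfl⟩ := List.cons.inj ht
      obtain rfl : x = 1 := by omega
      exact ⟨1 :: r, m + 1, hr, .detour h⟩
    · obtain ⟨r, m, hr, h⟩ := exists_of_steps (z' :: t) z (by simp_all) hz (by simp_all)
        fun e he => hsteps e (by rw [steps_cons_cons]; exact Multiset.mem_cons_of_mem he)
      obtain ⟨x, r, t', rfl, ht⟩ := h.exists_cons
      obtain ⟨rfl, rfl⟩ := List.cons.inj ht
      obtain ⟨y, rfl⟩ := Nat.exists_eq_succ_of_ne_zero (show y ≠ 0 by rintro rfl; simp at h0)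
      refine ⟨y :: x :: r, m, ?_, .step h⟩
      simp only [List.mem_cons, not_or] at hr ⊢
      exact ⟨by omega, hr⟩

lemma unique {r' : List ℕ} {m' : ℕ} (h : Inserted r m t) (h' : Inserted r' m' t)
    (h0 : 0 ∉ r) (h0' : 0 ∉ r') : r = r' := by
  induction h generalizing r' m' with
  | base =>
    cases h' with
    | base => rfl
    | step h' =>
      simp at h0'
  | step h ih =>
    cases h' with
    | base => cases h
    | step h' =>
      rw [ih h' (by simp_all) (by simp_all)]
    | detour h' => simp at h0
  | detour h ih =>
    cases h' with
    | step h' => simp at h0'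
    | detour h' => rw [ih h' (by simp_all) (by simp_all)]

/-- Excursions are distributed among the visits of `r` to `1` by stars and bars. -/
lemma encard_eq (r : List ℕ) (h0 : 0 ∉ r) (hr : r.getLast? = some 1) (m : ℕ) :
    {t | Inserted r m t}.encard = ((r.count 1).multichoose m : ℕ) := by
  match r, m with
  | [], m => simp at hr
  | [z], 0 =>
    obtain rfl : z = 1 := by simpa using hr
    have : {t | Inserted [1] 0 t} = {[2, 1]} := by
      ext t
      constructor
      · rintro ⟨⟩; rfl
      · rintro rfl; exact .base
    simp [this]
  | [z], m + 1 =>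
    obtain rfl : z = 1 := by simpa using hr
    have : {t | Inserted [1] (m + 1) t} = (fun t => 2 :: 1 :: t) '' {t | Inserted [1] m t} := by
      ext t
      constructor
      · rintro ⟨⟩
        exact ⟨_, ‹_›, rfl⟩
      · rintro ⟨t, h, rfl⟩
        obtain ⟨x, r, t, hr, rfl⟩ := Inserted.exists_cons h
        obtain ⟨rfl, rfl⟩ := List.cons.inj hr
        exact .detour h
    rw [this, Function.Injective.encard_image (fun a b h => by simpa using h),
      encard_eq _ h0 hr m]
    simp
  | x :: y :: r, m =>
    have hstep : {t | ∃ t', Inserted (y :: r) m t' ∧ t = (x + 1) :: t'}.encard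
        = (((y :: r).count 1).multichoose m : ℕ) := by
      rw [← encard_eq (y :: r) (by simp_all) (by simpa using hr) m,
        ← Function.Injective.encard_image (List.cons_injective (a := x + 1))
          {t | Inserted (y :: r) m t}]
      congr 1
      ext t
      simp [eq_comm]
    have hmk : ∀ {m t}, Inserted (y :: r) m t → Inserted (x :: y :: r) m ((x + 1) :: t) := by
      intro m t h
      obtain ⟨z, r', t, hr, rfl⟩ := h.exists_cons
      obtain ⟨rfl, rfl⟩ := List.cons.inj hr
      exact .step h
    by_cases hx : x = 1
    · subst hx
      match m with
      | 0 =>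
        have : {t | Inserted (1 :: y :: r) 0 t} =
            {t | ∃ t', Inserted (y :: r) 0 t' ∧ t = (1 + 1) :: t'} := by
          ext t
          constructor
          · rintro ⟨⟩
            exact ⟨_, ‹_›, rfl⟩
          · rintro ⟨t, h, rfl⟩
            exact hmk h
        rw [this, hstep]
        simp
      | m + 1 =>
        have : {t | Inserted (1 :: y :: r) (m + 1) t} =
            {t | ∃ t', Inserted (y :: r) (m + 1) t' ∧ t = (1 + 1) :: t'} ∪
              (fun t => 2 :: 1 :: t) '' {t | Inserted (1 :: y :: r) m t} := by
          ext t
          constructor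
          · rintro ⟨⟩
            · exact .inl ⟨_, ‹_›, rfl⟩
            · exact .inr ⟨_, ‹_›, rfl⟩
          · rintro (⟨t, h, rfl⟩ | ⟨t, h, rfl⟩)
            · exact hmk h
            · obtain ⟨x, r, t, hr, rfl⟩ := Inserted.exists_cons h
              obtain ⟨rfl, rfl⟩ := List.cons.inj hr
              exact .detour h
        rw [this, Set.encard_union_eq, hstep,
          Function.Injective.encard_image (fun a b h => by simpa using h),
          encard_eq _ h0 hr m, List.count_cons_self, Nat.multichoose_succ_succ]
        · norm_cast
        · rw [Set.disjoint_left]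
          rintro _ ⟨t, h, rfl⟩ ⟨t', -, ht'⟩
          obtain ⟨z, r', t, hr, rfl⟩ := h.exists_cons
          simp_all
    · have : {t | Inserted (x :: y :: r) m t} =
          {t | ∃ t', Inserted (y :: r) m t' ∧ t = (x + 1) :: t'} := by
        ext t
        constructor
        · rintro ⟨⟩
          · exact ⟨_, ‹_›, rfl⟩
          · exact absurd rfl hx
        · rintro ⟨t, h, rfl⟩
          exact hmk h
      rw [this, hstep, List.count_cons_of_ne hx]
termination_by (r.length, m)

lemma length_eq (h : Inserted r m t) : (1 :: t).length = r.length + 2 * (m + 1) := by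
  induction h <;> simp at * <;> omega

lemma steps_cons_eq (h : Inserted (1 :: r) m t) :
    steps (1 :: t) = (steps (1 :: r)).map (Prod.map (· + 1) (· + 1))
      + (m + 1) • {(1, 2)} + (m + 1) • {(2, 1)} := by
  obtain ⟨x, r', t', hr, rfl⟩ := h.exists_cons
  obtain ⟨rfl, rfl⟩ := List.cons.inj hr
  rw [steps_cons_cons, h.steps_eq, ← Multiset.singleton_add]
  simp only [add_nsmul, one_nsmul]
  ac_rfl

lemma mem_steps_cons_iff (h : Inserted (1 :: r) m t) (z : ℕ × ℕ) :
    z ∈ steps (1 :: t) ↔ z = (1, 2) ∨ z = (2, 1) ∨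
      ∃ x y, (x, y) ∈ steps (1 :: r) ∧ z = (x + 1, y + 1) := by
  rw [h.steps_cons_eq]
  simp only [Multiset.mem_add, Multiset.mem_map, Multiset.mem_nsmul, Multiset.mem_singleton,
    Prod.exists, Prod.map_apply]
  constructor
  · rintro ((⟨x, y, hxy, rfl⟩ | ⟨-, rfl⟩) | ⟨-, rfl⟩)
    · exact .inr (.inr ⟨x, y, hxy, rfl⟩)
    · simp
    · simp
  · rintro (rfl | rfl | ⟨x, y, hxy, rfl⟩)
    · simp
    · simp
    · exact .inl (.inl ⟨x, y, hxy, rfl⟩)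

lemma vertexSet_eq (h : Inserted (1 :: r) m t) :
    vertexSet (1 :: t) = insert 1 ((vertexSet (1 :: r)).image (· + 1)) := by
  ext z
  simp only [vertexSet, List.mem_toFinset, List.mem_cons (b := 1) (l := t), h.mem_iff,
    Finset.mem_insert, Finset.mem_image, @eq_comm _ z]
  tauto

lemma edgeSet_eq {k : ℕ} (h : Inserted (1 :: r) m t) (hk : (1 :: r).length = k + 1) :
    edgeSet (k + 2 * (m + 1)) (1 :: t)
      = insert s(1, 2) ((edgeSet k (1 :: r)).image (Sym2.map (· + 1))) := by
  rw [_root_.edgeSet_eq (k := k) hk, _root_.edgeSet_eq (by rw [h.length_eq, hk]; omega)]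
  ext e
  simp only [Multiset.mem_toFinset, Multiset.mem_map, h.mem_steps_cons_iff, Finset.mem_insert,
    Finset.mem_image]
  constructor
  · rintro ⟨z, rfl | rfl | ⟨x, y, hxy, rfl⟩, rfl⟩
    · simp
    · simp [Sym2.eq_swap]
    · exact .inr ⟨_, ⟨_, hxy, rfl⟩, rfl⟩
  · rintro (rfl | ⟨_, ⟨⟨x, y⟩, hxy, rfl⟩, rfl⟩)
    · exact ⟨(1, 2), by simp⟩
    · exact ⟨(x + 1, y + 1), .inr (.inr ⟨x, y, hxy, rfl⟩), rfl⟩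

lemma rootEdge_notMem {k : ℕ} (hk : (1 :: r).length = k + 1) (h0 : 0 ∉ r) :
    s(1, 2) ∉ (edgeSet k (1 :: r)).image (Sym2.map (· + 1)) := by
  rw [Finset.mem_image]
  rintro ⟨e, he, h⟩
  induction e with | _ x y
  have hxy : x ≠ 0 ∧ y ≠ 0 := by
    have : ∀ {x}, x ∈ 1 :: r → x ≠ 0 := by
      rintro x hx rfl
      simp_all
    rcases (mem_edgeSet_iff hk _ _).1 he with H | H
    · exact ⟨this (mem_of_mem_steps H).1, this (mem_of_mem_steps H).2⟩
    · exact ⟨this (mem_of_mem_steps H).2, this (mem_of_mem_steps H).1⟩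
  simp [hxy] at h

lemma card_edgeSet {k : ℕ} (h : Inserted (1 :: r) m t) (hk : (1 :: r).length = k + 1)
    (h0 : 0 ∉ r) :
    (edgeSet (k + 2 * (m + 1)) (1 :: t)).card = (edgeSet k (1 :: r)).card + 1 := by
  rw [h.edgeSet_eq hk, Finset.card_insert_of_notMem (rootEdge_notMem hk h0),
    Finset.card_image_of_injective _ (Sym2.map.injective (add_left_injective 1))]

lemma card_vertexSet (h : Inserted (1 :: r) m t) (h0 : 0 ∉ r) :
    (vertexSet (1 :: t)).card = (vertexSet (1 :: r)).card + 1 := by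
  rw [h.vertexSet_eq, Finset.card_insert_of_notMem (by simpa [vertexSet] using h0),
    Finset.card_image_of_injective _ (add_left_injective 1)]

lemma isEssential_iff {k : ℕ} (h : Inserted (1 :: r) m t) (h0 : 0 ∉ r) :
    IsEssential (k + 2 * (m + 1)) (1 :: t) ↔ IsEssential k (1 :: r) := by
  have hlen : (1 :: t).length = k + 2 * (m + 1) + 1 ↔ (1 :: r).length = k + 1 := by
    rw [h.length_eq]; omega
  by_cases hk : (1 :: r).length = k + 1
  swap
  · exact iff_of_false (fun H => hk (hlen.1 H.1.1)) fun H => hk H.1.1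
  have hk' := hlen.2 hk
  have hne : (∀ z ∈ steps (1 :: t), z.1 ≠ z.2) ↔ ∀ z ∈ steps (1 :: r), z.1 ≠ z.2 := by
    simp only [h.mem_steps_cons_iff]
    constructor
    · intro H z hz
      simpa using H (z.1 + 1, z.2 + 1) (.inr (.inr ⟨_, _, hz, rfl⟩))
    · rintro H z (rfl | rfl | ⟨x, y, hxy, rfl⟩)
      · simp
      · simp
      · simpa using H _ hxy
  have hlast : (1 :: t).getLast? = some 1 := by
    rw [List.getLast?_cons, h.getLast.2]
    rfl
  have hclosed : IsClosedWalk (k + 2 * (m + 1)) (1 :: t) ↔ IsClosedWalk k (1 :: r) := by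
    rw [isClosedWalk_iff, isClosedWalk_iff, hne, hlast, h.getLast.1, hlen]
    rfl
  have hmin : IsMinimal (k + 2 * (m + 1)) (1 :: t) ↔ IsMinimal k (1 :: r) := by
    rw [isMinimal_iff hk', isMinimal_iff hk]
    obtain ⟨x, r', t', hr, rfl⟩ := h.exists_cons
    obtain ⟨rfl, rfl⟩ := List.cons.inj hr
    rw [← h.minimalFrom_iff (S := {1}) (by simpa using h0) (by simp) (by simp) (by simp)]
    simp [MinimalFrom, Finset.pair_comm]
  rw [IsEssential, IsEssential, hclosed, hmin]
  refine and_congr_right fun H => and_congr_right fun _ => ?_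
  have hne₀ := (isClosedWalk_iff.1 H).2.2
  rw [skeleton_isTree_iff hk hne₀, skeleton_isTree_iff hk' (hne.2 hne₀), h.card_edgeSet hk h0,
    h.card_vertexSet h0]
  omega

lemma traversals_rootEdge {k : ℕ} (h : Inserted (1 :: r) m t) (hk : (1 :: r).length = k + 1)
    (h0 : 0 ∉ r) : traversals (k + 2 * (m + 1)) (1 :: t) s(1, 2) = 2 * (m + 1) := by
  rw [traversals_eq (by rw [h.length_eq, hk]; omega), h.steps_cons_eq]
  have : (steps (1 :: r)).countP (fun z => s(z.1 + 1, z.2 + 1) = s(1, 2)) = 0 := by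
    rw [Multiset.countP_eq_zero]
    rintro ⟨x, y⟩ hz he
    have := (mem_edgeSet_iff hk x y).2 (.inl hz)
    exact rootEdge_notMem hk h0 (Finset.mem_image.2 ⟨_, this, he⟩)
  simp only [Multiset.countP_add, Multiset.countP_map, Multiset.countP_nsmul,
    ← Multiset.countP_eq_card_filter, Prod.map_fst, Prod.map_snd, this]
  simp [← Multiset.cons_zero]
  omega

lemma traversals_map {k : ℕ} (h : Inserted (1 :: r) m t) (hk : (1 :: r).length = k + 1)
    (h0 : 0 ∉ r) {e : Sym2 ℕ} (he : e ∈ edgeSet k (1 :: r)) :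
    traversals (k + 2 * (m + 1)) (1 :: t) (e.map (· + 1)) = traversals k (1 :: r) e := by
  have hne : s(1, 2) ≠ e.map (· + 1) := fun H =>
    rootEdge_notMem hk h0 (Finset.mem_image.2 ⟨e, he, H.symm⟩)
  have hne' : s(2, 1) ≠ e.map (· + 1) := by rwa [Sym2.eq_swap]
  rw [traversals_eq (by rw [h.length_eq, hk]; omega), traversals_eq hk, h.steps_cons_eq]
  have (z : ℕ × ℕ) : s(z.1 + 1, z.2 + 1) = e.map (· + 1) ↔ s(z.1, z.2) = e :=
    (Sym2.map.injective (add_left_injective 1)).eq_iff (a := s(z.1, z.2))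
  simp only [Multiset.countP_add, Multiset.countP_map, Multiset.countP_nsmul,
    ← Multiset.countP_eq_card_filter, Prod.map_fst, Prod.map_snd, this]
  simp [← Multiset.cons_zero, hne, hne']

lemma rootSteps_eq {k : ℕ} (h : Inserted (1 :: r) m t) (hk : (1 :: r).length = k + 1)
    (h0 : 0 ∉ r) : rootSteps (k + 2 * (m + 1)) (1 :: t) = m + 1 := by
  rw [_root_.rootSteps_eq (by rw [h.length_eq, hk]; omega), h.steps_cons_eq]
  have : (steps (1 :: r)).countP (fun z => z.1 + 1 = 1) = 0 := by
    rw [Multiset.countP_eq_zero]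
    rintro ⟨x, y⟩ hz he
    have := (mem_of_mem_steps hz).1
    simp_all
  simp only [Multiset.countP_add, Multiset.countP_map, Multiset.countP_nsmul,
    ← Multiset.countP_eq_card_filter, Prod.map_fst, this, List.getD_cons_zero]
  simp [← Multiset.cons_zero]

lemma nuOutSteps_eq {k : ℕ} (h : Inserted (1 :: r) m t) (hk : (1 :: r).length = k + 1)
    (h0 : 0 ∉ r) : nuOutSteps (k + 2 * (m + 1)) (1 :: t) = rootSteps k (1 :: r) := by
  rw [_root_.nuOutSteps_eq (by rw [h.length_eq, hk]; omega), _root_.rootSteps_eq hk,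
    h.steps_cons_eq]
  obtain ⟨x, r', t', hr, rfl⟩ := h.exists_cons
  obtain ⟨rfl, rfl⟩ := List.cons.inj hr
  have : (steps (1 :: r)).countP (fun z => z.1 + 1 = 2 ∧ z.2 + 1 ≠ 1)
      = (steps (1 :: r)).countP (fun z => z.1 = 1) := by
    refine Multiset.countP_congr rfl ?_
    rintro ⟨x, y⟩ hz
    have := (mem_of_mem_steps hz).2
    have hy : y ≠ 0 := by
      rintro rfl
      simp_all
    simp [hy]
  simp only [Multiset.countP_add, Multiset.countP_map, Multiset.countP_nsmul,
    ← Multiset.countP_eq_card_filter, Prod.map_fst, Prod.map_snd, List.getD_cons_zero,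
    List.getD_cons_succ, Nat.reduceAdd, this]
  simp [← Multiset.cons_zero]

lemma card_rootEdges {k : ℕ} (h : Inserted (1 :: r) m t) (hk : (1 :: r).length = k + 1)
    (h0 : 0 ∉ r) :
    ((edgeSet (k + 2 * (m + 1)) (1 :: t)).filter fun e => 1 ∈ e).card = 1 := by
  rw [h.edgeSet_eq hk, Finset.card_eq_one]
  refine ⟨s(1, 2), ?_⟩
  ext e
  simp only [Finset.mem_filter, Finset.mem_insert, Finset.mem_image, Finset.mem_singleton]
  constructor
  · rintro ⟨rfl | ⟨e, he, rfl⟩, h1⟩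
    · rfl
    · exfalso
      induction e with | _ x y
      have : x ∈ 1 :: r ∧ y ∈ 1 :: r := by
        rcases (mem_edgeSet_iff hk _ _).1 he with H | H
        · exact mem_of_mem_steps H
        · exact (mem_of_mem_steps H).symm
      simp at h1
      rcases h1 with rfl | rfl <;> simp_all
  · rintro rfl
    simp

lemma beta_eq {k : ℕ} (h : Inserted (1 :: r) m t) (h0 : 0 ∉ r) (hw : IsEssential k (1 :: r)) :
    beta (k + 2 * (m + 1)) (1 :: t) = (vertexSet (1 :: r)).card - beta k (1 :: r) + 1 := by
  have hw' := (h.isEssential_iff h0).2 hw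
  obtain ⟨hk, -, hne⟩ := isClosedWalk_iff.1 hw.1
  obtain ⟨hk', -, hne'⟩ := isClosedWalk_iff.1 hw'.1
  have hpos : ∀ {x}, x ∈ 1 :: r → x ≠ 0 := by
    rintro x hx rfl
    simp_all
  have hdist : ∀ x ∈ 1 :: r, (skeleton (k + 2 * (m + 1)) (1 :: t)).dist 1 (x + 1)
      = (skeleton k (1 :: r)).dist 1 x + 1 := by
    intro x hx
    refine dist_one_succ ?_ ?_ ?_ (hpos hx) (skeleton_reachable hk hne hx)
    · intro a b hab
      simp only [skeleton_adj hk' hne', h.mem_steps_cons_iff, Prod.mk.injEq] at hab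
      rcases hab with (⟨rfl, rfl⟩ | ⟨rfl, rfl⟩ | ⟨x, y, hxy, rfl, rfl⟩) |
        (⟨rfl, rfl⟩ | ⟨rfl, rfl⟩ | ⟨x, y, hxy, rfl, rfl⟩)
      · simp
      · simp
      · exact .inr (.inr ⟨x, y, rfl, rfl, hpos (mem_of_mem_steps hxy).1,
          hpos (mem_of_mem_steps hxy).2, (skeleton_adj hk hne _ _).2 (.inl hxy)⟩)
      · simp
      · simp
      · exact .inr (.inr ⟨y, x, rfl, rfl, hpos (mem_of_mem_steps hxy).2,
          hpos (mem_of_mem_steps hxy).1, (skeleton_adj hk hne _ _).2 (.inr hxy)⟩)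
    · simp [skeleton_adj hk' hne', h.mem_steps_cons_iff]
    · intro x y hxy
      simp only [skeleton_adj hk' hne', h.mem_steps_cons_iff]
      rcases (skeleton_adj hk hne _ _).1 hxy with H | H
      · exact .inl (.inr (.inr ⟨x, y, H, rfl⟩))
      · exact .inr (.inr (.inr ⟨y, x, H, rfl⟩))
  have hβ : beta k (1 :: r) = ((vertexSet (1 :: r)).filter fun v =>
      Even ((skeleton k (1 :: r)).dist 1 v)).card := by
    rw [beta, ← Set.ncard_coe_finset]
    simp
  have hβ' : {v | v ∈ vertexSet (1 :: t) ∧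
      Even ((skeleton (k + 2 * (m + 1)) (1 :: t)).dist ((1 :: t).getD 0 0) v)} =
      ↑(insert 1 (((vertexSet (1 :: r)).filter fun v =>
        ¬ Even ((skeleton k (1 :: r)).dist 1 v)).image (· + 1))) := by
    ext v
    simp only [h.vertexSet_eq, Set.mem_ofPred_eq, Finset.mem_insert, Finset.mem_image,
      Finset.mem_filter, Finset.mem_coe, List.getD_cons_zero]
    constructor
    · rintro ⟨rfl | ⟨x, hx, rfl⟩, hv⟩
      · simp
      · rw [hdist x (by simpa [vertexSet] using hx), Nat.even_add_one] at hv
        exact .inr ⟨x, ⟨hx, hv⟩, rfl⟩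
    · rintro (rfl | ⟨x, ⟨hx, hv⟩, rfl⟩)
      · simp
      · rw [hdist x (by simpa [vertexSet] using hx), Nat.even_add_one]
        exact ⟨.inr ⟨x, hx, rfl⟩, hv⟩
  rw [beta, hβ', Set.ncard_coe_finset, Finset.card_insert_of_notMem,
    Finset.card_image_of_injective _ (add_left_injective 1), hβ]
  · have := Finset.card_filter_add_card_filter_not (s := vertexSet (1 :: r))
      fun v => Even ((skeleton k (1 :: r)).dist 1 v)
    omega
  · simp [vertexSet]
    intro H
    exact absurd H h0

lemma prod_edgeSet {k : ℕ} (h : Inserted (1 :: r) m t) (hk : (1 :: r).length = k + 1)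
    (h0 : 0 ∉ r) (p : ℝ) (X : ℕ → ℝ) :
    ∏ e ∈ edgeSet (k + 2 * (m + 1)) (1 :: t), p * X (traversals (k + 2 * (m + 1)) (1 :: t) e)
      = p * X (2 * (m + 1)) * ∏ e ∈ edgeSet k (1 :: r), p * X (traversals k (1 :: r) e) := by
  rw [h.edgeSet_eq hk, Finset.prod_insert (rootEdge_notMem hk h0), h.traversals_rootEdge hk h0,
    Finset.prod_image (Sym2.map.injective (add_left_injective 1)).injOn]
  congr 1
  exact Finset.prod_congr rfl fun e he => by rw [h.traversals_map hk h0 he]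

lemma card_vertexSet_sub_beta {k : ℕ} (h : Inserted (1 :: r) m t) (h0 : 0 ∉ r)
    (hw : IsEssential k (1 :: r)) :
    (vertexSet (1 :: t)).card - beta (k + 2 * (m + 1)) (1 :: t) = beta k (1 :: r) := by
  have hle : beta k (1 :: r) ≤ (vertexSet (1 :: r)).card := by
    rw [beta, ← Set.ncard_coe_finset]
    exact Set.ncard_le_ncard (fun x hx => hx.1) (Finset.finite_toSet _)
  rw [h.beta_eq h0 hw, h.card_vertexSet h0]
  omega

lemma theta1_eq {k : ℕ} (h : Inserted (1 :: r) m t) (h0 : 0 ∉ r) (hw : IsEssential k (1 :: r))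
    (p α : ℝ) (X : ℕ → ℝ) :
    theta1 p α X (k + 2 * (m + 1)) (1 :: t)
      = α * (p * X (2 * (m + 1))) * theta2 p α X k (1 :: r) := by
  rw [theta1, theta2, h.card_vertexSet_sub_beta h0 hw, h.beta_eq h0 hw,
    h.prod_edgeSet hw.1.1 h0]
  ring

lemma theta2_eq {k : ℕ} (h : Inserted (1 :: r) m t) (h0 : 0 ∉ r) (hw : IsEssential k (1 :: r))
    (p α : ℝ) (X : ℕ → ℝ) :
    theta2 p α X (k + 2 * (m + 1)) (1 :: t)
      = (1 - α) * (p * X (2 * (m + 1))) * theta1 p α X k (1 :: r) := by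
  rw [theta1, theta2, h.card_vertexSet_sub_beta h0 hw, h.beta_eq h0 hw,
    h.prod_edgeSet hw.1.1 h0]
  ring

end Inserted

lemma IsEssential.exists_eq_cons {k : ℕ} {w : List ℕ} (h : IsEssential k w) :
    ∃ r, w = 1 :: r ∧ (∀ x ∈ r, 0 < x ∧ x ≤ k + 1) ∧ MinimalFrom {1} r := by
  obtain ⟨hw, hmin, -⟩ := h
  match w with
  | [] => simpa using hw.1
  | a :: r =>
    obtain ⟨rfl, hr⟩ := (isMinimal_iff hw.1).1 hmin
    refine ⟨r, rfl, ?_, hr⟩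
    have := hr.bounds (by simp)
    have hlen := hw.1
    intro x hx
    specialize this x hx
    simp only [Finset.card_singleton, List.length_cons] at this hlen
    omega

lemma IsEssential.zero_notMem {k : ℕ} {r : List ℕ} (h : IsEssential k (1 :: r)) : 0 ∉ r := by
  obtain ⟨_, hr, hpos, -⟩ := h.exists_eq_cons
  obtain ⟨-, rfl⟩ := List.cons.inj hr
  exact fun h0 => (hpos 0 h0).1.ne rfl

lemma finite_Lambda (l r : ℕ) : (Lambda l r).Finite := by
  refine ((List.finite_length_eq (Fin (2 * l + 2)) (2 * l + 1)).image
    (List.map Fin.val)).subset ?_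
  rintro w ⟨hw, -⟩
  obtain ⟨t, rfl, ht, -⟩ := hw.exists_eq_cons
  have hlt : ∀ x ∈ 1 :: t, x < 2 * l + 2 := by
    intro x hx
    rcases List.mem_cons.1 hx with rfl | hx
    · omega
    · have := ht x hx
      omega
  refine ⟨(1 :: t).pmap Fin.mk hlt, ?_, ?_⟩
  · simpa using hw.1.1
  · rw [List.map_pmap]
    simp

lemma rootSteps_le {l r : ℕ} {w : List ℕ} (hw : w ∈ Lambda l r) : r ≤ l := by
  obtain ⟨hw, rfl⟩ := hw
  obtain ⟨t, rfl, -⟩ := hw.exists_eq_cons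
  obtain ⟨hk, -, hne⟩ := isClosedWalk_iff.1 hw.1
  have := two_mul_countP_le 1 t hne
  rw [rootSteps_eq hk, List.getD_cons_zero]
  rw [card_steps hk, if_pos rfl] at this
  omega

lemma count_one_eq {w : List ℕ} (h : w.getLast? = some 1) :
    w.count 1 = (steps w).countP (fun x => x.1 = 1) + 1 := by
  match w with
  | [a] =>
    obtain rfl : a = 1 := by simpa using h
    simp
  | a :: b :: t =>
    rw [List.count_cons, count_one_eq (w := b :: t) (by simpa using h), steps_cons_cons,
      Multiset.countP_cons]
    simp only [beq_iff_eq]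
    omega

/-- Removing the root and its edge from a walk whose skeleton has one edge at the root. -/
lemma exists_inserted_of_mem_Lambda2 {m u : ℕ} {w : List ℕ}
    (hw : w ∈ Lambda2 (m + 1 + u) (m + 1)) :
    ∃ r t, w = 1 :: t ∧ Inserted (1 :: r) m t ∧
      1 :: r ∈ Lambda u (nuOutSteps (2 * (m + 1 + u)) w) := by
  obtain ⟨⟨hw, hroot⟩, hcard⟩ := hw
  obtain ⟨t, rfl, hpos, hmin⟩ := hw.exists_eq_cons
  obtain ⟨hk, hlast, hne⟩ := isClosedWalk_iff.1 hw.1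
  match t with
  | [] => simp at hk
  | y :: t =>
    obtain rfl : y = 2 := by
      have h₁ := hne (1, y) (by simp)
      have h₂ := hmin.1
      simp at h₁ h₂
      omega
    rw [List.getD_cons_zero, Finset.card_eq_one] at hcard
    obtain ⟨e, he⟩ := hcard
    have hroots : ∀ b, s(1, b) ∈ edgeSet (2 * (m + 1 + u)) (1 :: 2 :: t) → s(1, b) = e :=
      fun b hb => Finset.mem_singleton.1 (he ▸ Finset.mem_filter.2 ⟨hb, by simp⟩)
    have h12 := hroots 2 ((mem_edgeSet_iff hk _ _).2 (by simp))
    have hroots' : ∀ b, s(1, b) ∈ edgeSet (2 * (m + 1 + u)) (1 :: 2 :: t) → b = 2 := by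
      intro b hb
      have := (hroots b hb).trans h12.symm
      simpa using this
    have hsteps : ∀ z ∈ steps (1 :: 2 :: t),
        (z.1 = 1 ↔ z = (1, 2)) ∧ (z.2 = 1 ↔ z = (2, 1)) := by
      rintro ⟨a, b⟩ hz
      refine ⟨⟨?_, by simp_all⟩, ⟨?_, by simp_all⟩⟩
      · rintro rfl
        rw [hroots' b ((mem_edgeSet_iff hk _ _).2 (.inl hz))]
      · rintro rfl
        rw [hroots' a ((mem_edgeSet_iff hk _ _).2 (.inr hz))]
    obtain ⟨r, m', hr, h⟩ := Inserted.exists_of_steps t 2 (fun h0 => (hpos 0 h0).1.ne rfl)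
      (by simp) (by simpa using hlast)
      fun e he => hsteps e (by rw [steps_cons_cons]; exact Multiset.mem_cons_of_mem he)
    obtain ⟨x, r, t', rfl, ht⟩ := h.exists_cons
    obtain rfl : x = 1 := by simpa using (List.cons.inj ht).1.symm
    have hr0 : 0 ∉ r := fun h0 => hr (List.mem_cons_of_mem _ h0)
    have hlen : 2 * (m + 1 + u) = r.length + 2 * (m' + 1) := by
      have := h.length_eq
      rw [hk] at this
      simp only [List.length_cons] at this
      omega
    have hrk : (1 :: r).length = r.length + 1 := rfl
    rw [hlen] at hw hroot
    obtain rfl : m' = m := by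
      rw [h.rootSteps_eq hrk hr0] at hroot
      omega
    have hru : r.length = 2 * u := by omega
    refine ⟨r, 2 :: t, rfl, h, ?_⟩
    rw [hlen, h.nuOutSteps_eq hrk hr0, hru]
    rw [hru] at hw
    exact ⟨(h.isEssential_iff hr0).1 hw, rfl⟩

lemma Lambda3_eq (m u v : ℕ) :
    Lambda3 (m + 1 + u) (m + 1) v =
      ⋃ w ∈ Lambda u v, List.cons 1 '' {t | Inserted w m t} := by
  ext w
  simp only [Set.mem_iUnion, exists_prop]
  constructor
  · rintro ⟨hw, rfl⟩
    obtain ⟨r, t, rfl, h, hr⟩ := exists_inserted_of_mem_Lambda2 hw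
    exact ⟨_, hr, t, h, rfl⟩
  · rintro ⟨w, ⟨hw, rfl⟩, t, h, rfl⟩
    obtain ⟨r, rfl, -⟩ := hw.exists_eq_cons
    have h0 := hw.zero_notMem
    have hk := hw.1.1
    rw [Lambda3, show 2 * (m + 1 + u) = 2 * u + 2 * (m + 1) by ring]
    refine ⟨⟨⟨?_, ?_⟩, ?_⟩, h.nuOutSteps_eq hk h0⟩
    · rw [show 2 * (m + 1 + u) = 2 * u + 2 * (m + 1) by ring]
      exact (h.isEssential_iff h0).2 hw
    · rw [show 2 * (m + 1 + u) = 2 * u + 2 * (m + 1) by ring]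
      exact h.rootSteps_eq hk h0
    · rw [show 2 * (m + 1 + u) = 2 * u + 2 * (m + 1) by ring]
      exact h.card_rootEdges hk h0

lemma ncard_inserted {m u v : ℕ} {w : List ℕ} (hw : w ∈ Lambda u v) :
    {t | Inserted w m t}.Finite ∧ {t | Inserted w m t}.ncard = (m + v).choose m := by
  obtain ⟨hw, rfl⟩ := hw
  obtain ⟨r, rfl, -⟩ := hw.exists_eq_cons
  obtain ⟨hk, hlast, -⟩ := isClosedWalk_iff.1 hw.1
  have hcard := Inserted.encard_eq (1 :: r) (by simpa using hw.zero_notMem) hlast m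
  refine ⟨Set.finite_of_encard_eq_coe hcard, ?_⟩
  rw [Set.ncard_def, hcard, ENat.toNat_natCast, count_one_eq hlast, Nat.multichoose_eq,
    rootSteps_eq hk, List.getD_cons_zero]
  congr 1
  omega

lemma finsum_Lambda3 {m u v : ℕ} (g g' : List ℕ → ℝ) (c : ℝ)
    (hg : ∀ r t, IsEssential (2 * u) (1 :: r) → Inserted (1 :: r) m t →
      g (1 :: t) = c * g' (1 :: r)) :
    ∑ᶠ w ∈ Lambda3 (m + 1 + u) (m + 1) v, g w
      = c * ((m + v).choose m : ℝ) * ∑ᶠ w ∈ Lambda u v, g' w := by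
  rw [Lambda3_eq, finsum_mem_biUnion _ (finite_Lambda u v)
    fun w hw => (ncard_inserted hw).1.image _, mul_finsum_mem]
  · refine finsum_mem_congr rfl fun w hw => ?_
    obtain ⟨hfin, hcard⟩ := ncard_inserted (m := m) hw
    obtain ⟨r, rfl, -⟩ := hw.1.exists_eq_cons
    rw [finsum_mem_image List.cons_injective.injOn,
      finsum_mem_congr (s := {t | Inserted (1 :: r) m t}) rfl fun t ht => hg r t hw.1 ht,
      finsum_mem_eq_finite_toFinset_sum _ hfin, Finset.sum_const,
      ← Set.ncard_eq_toFinset_card _ hfin, hcard, nsmul_eq_mul]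
    ring
  · intro w hw w' hw' hne
    rw [Function.onFun, Set.disjoint_left]
    rintro _ ⟨t, h, rfl⟩ ⟨t', h', ht⟩
    obtain rfl := List.cons_injective ht
    obtain ⟨r, rfl, -⟩ := hw.1.exists_eq_cons
    obtain ⟨r', rfl, -⟩ := hw'.1.exists_eq_cons
    exact hne (Inserted.unique h h' (by simpa using hw.1.zero_notMem)
      (by simpa using hw'.1.zero_notMem))

lemma finsum_Lambda2 {m u : ℕ} (g : List ℕ → ℝ) :
    ∑ᶠ w ∈ Lambda2 (m + 1 + u) (m + 1), g w
      = ∑ v ∈ Finset.range (u + 1), ∑ᶠ w ∈ Lambda3 (m + 1 + u) (m + 1) v, g w := by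
  have hU : Lambda2 (m + 1 + u) (m + 1)
      = ⋃ v ∈ (↑(Finset.range (u + 1)) : Set ℕ), Lambda3 (m + 1 + u) (m + 1) v := by
    ext w
    simp only [Set.mem_iUnion, exists_prop]
    constructor
    · intro hw
      obtain ⟨r, t, -, -, hr⟩ := exists_inserted_of_mem_Lambda2 hw
      exact ⟨_, by simpa [Nat.lt_succ_iff] using rootSteps_le hr, hw, rfl⟩
    · rintro ⟨v, -, hw, -⟩
      exact hw
  rw [hU, finsum_mem_biUnion _ (Finset.finite_toSet _)
    fun v _ => (finite_Lambda _ _).subset fun w hw => hw.1.1, finsum_mem_coe_finset]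
  intro v _ v' _ hne
  rw [Function.onFun, Set.disjoint_left]
  rintro w ⟨-, rfl⟩ ⟨-, rfl⟩
  exact hne rfl

/-- **Second decomposition lemma.** `S⁽ⁱ⁾_2(f+u,f) = Σ_{v=0}^{u} S⁽ⁱ⁾_3(f+u,f,v)`, where
`S⁽¹⁾_3(f+u,f,v) = α C(f+v-1,f-1) p X_{2f} S⁽²⁾(u,v)` and
`S⁽²⁾_3(f+u,f,v) = (1-α) C(f+v-1,f-1) p X_{2f} S⁽¹⁾(u,v)`. -/
theorem second_decomposition_lemma
    (p α : ℝ) (X : ℕ → ℝ)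
    (hα : α ∈ Set.Ioo (0 : ℝ) 1) (hp : 0 < p) (hXnonneg : ∀ f : ℕ, 0 ≤ X (2 * f)) :
    (∀ f u : ℕ, 1 ≤ f →
      S1₂ p α X (f + u) f = ∑ v ∈ Finset.range (u + 1), S1₃ p α X (f + u) f v) ∧
    (∀ f u : ℕ, 1 ≤ f →
      S2₂ p α X (f + u) f = ∑ v ∈ Finset.range (u + 1), S2₃ p α X (f + u) f v) ∧
    (∀ f u v : ℕ, 1 ≤ f → v ≤ u →
      S1₃ p α X (f + u) f v =
        α * ((f + v - 1).choose (f - 1) : ℝ) * (p * X (2 * f)) * S2 p α X u v) ∧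
    (∀ f u v : ℕ, 1 ≤ f → v ≤ u →
      S2₃ p α X (f + u) f v =
        (1 - α) * ((f + v - 1).choose (f - 1) : ℝ) * (p * X (2 * f)) * S1 p α X u v) := by
  refine ⟨?_, ?_, ?_, ?_⟩
  · intro f u hf
    obtain ⟨m, rfl⟩ := Nat.exists_eq_add_of_le' hf
    exact finsum_Lambda2 _
  · intro f u hf
    obtain ⟨m, rfl⟩ := Nat.exists_eq_add_of_le' hf
    exact finsum_Lambda2 _
  · intro f u v hf _
    obtain ⟨m, rfl⟩ := Nat.exists_eq_add_of_le' hf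
    rw [S1₃, S2, finsum_Lambda3 _ (theta2 p α X (2 * u)) (α * (p * X (2 * (m + 1))))]
    · rw [show m + 1 + v - 1 = m + v by omega, Nat.add_sub_cancel]
      ring
    · intro r t hr h
      rw [show 2 * (m + 1 + u) = 2 * u + 2 * (m + 1) by ring]
      exact h.theta1_eq hr.zero_notMem hr p α X
  · intro f u v hf _
    obtain ⟨m, rfl⟩ := Nat.exists_eq_add_of_le' hf
    rw [S2₃, S1, finsum_Lambda3 _ (theta1 p α X (2 * u)) ((1 - α) * (p * X (2 * (m + 1))))]
    · rw [show m + 1 + v - 1 = m + v by omega, Nat.add_sub_cancel]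
      ring
    · intro r t hr h
      rw [show 2 * (m + 1 + u) = 2 * u + 2 * (m + 1) by ring]
      exact h.theta2_eq hr.zero_notMem hr p α X
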